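/- Let α > 0, m > α, set a = m − α, and let f be a density solution to the equation x^m f(x) = (1/Γ(α)) ∫_0^x (x−v)^{α−1} f(v) dv on (0,∞). Define the Mellin transform M(s) = ∫_0^∞ x^{−s} f(x) dx, taking values in [0,∞]. Then for every s > −a one has M(s+a) · Γ(a+s) = M(s) · Γ(m+s), as an identity in [0,∞]. -/

import Mathlib

open MeasureTheory Real Set Filter

noncomputable section

/-- `f` is a density solution to the integro-differential equation
`I^α_{0+} f = x^m f` on `(0,∞)`: `f` is measurable, nonnegative on `(0,∞)`,
integrates to `1` on `(0,∞)`, and satisfies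
`x^m f(x) = (1/Γ(α)) ∫_0^x (x−v)^{α−1} f(v) dv` for every `x > 0`. -/
def IsDensitySolution (α m : ℝ) (f : ℝ → ℝ) : Prop :=
  Measurable f ∧ (∀ x ∈ Set.Ioi (0:ℝ), 0 ≤ f x) ∧
  (∫ x in Set.Ioi (0:ℝ), f x) = 1 ∧
  ∀ x ∈ Set.Ioi (0:ℝ),
    x ^ m * f x = (1 / Real.Gamma α) * ∫ v in Set.Ioo (0:ℝ) x, (x - v) ^ (α - 1) * f v

/-- The Gamma integral, as a Lebesgue integral in `[0,∞]`. -/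
lemma lintegral_rpow_mul_exp_neg_mul_Ioi {a r : ℝ} (ha : 0 < a) (hr : 0 < r) :
    ∫⁻ t in Ioi (0:ℝ), ENNReal.ofReal (t ^ (a - 1)) * ENNReal.ofReal (Real.exp (-(r * t))) =
      ENNReal.ofReal (r ^ (-a)) * ENNReal.ofReal (Real.Gamma a) := by
  have hint := Real.integral_rpow_mul_exp_neg_mul_Ioi ha hr
  have hpos : 0 < (1 / r) ^ a * Real.Gamma a :=
    mul_pos (Real.rpow_pos_of_pos (by positivity) _) (Real.Gamma_pos_of_pos ha)
  have hI : Integrable (fun t : ℝ => t ^ (a - 1) * Real.exp (-(r * t)))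
      (volume.restrict (Ioi 0)) := by
    by_contra h
    rw [integral_undef h] at hint
    exact hpos.ne hint
  have hnn : 0 ≤ᵐ[volume.restrict (Ioi (0:ℝ))]
      fun t : ℝ => t ^ (a - 1) * Real.exp (-(r * t)) := by
    filter_upwards [ae_restrict_mem measurableSet_Ioi] with t ht
    exact mul_nonneg (Real.rpow_nonneg (le_of_lt ht) _) (Real.exp_pos _).le
  have key := ofReal_integral_eq_lintegral_ofReal hI hnn
  rw [hint, one_div, Real.inv_rpow hr.le, ← Real.rpow_neg hr.le,
    ENNReal.ofReal_mul (Real.rpow_nonneg hr.le _)] at key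
  rw [key]
  refine setLIntegral_congr_fun measurableSet_Ioi fun t ht => ?_
  exact (ENNReal.ofReal_mul (Real.rpow_nonneg (le_of_lt ht) _)).symm

/-- A causal convolution on `(0,x)` as an integral over `(0,∞)` with a truncated kernel. -/
lemma lintegral_Ioo_sub_eq_indicator (k g : ℝ → ENNReal) (x : ℝ) :
    ∫⁻ v in Ioo (0:ℝ) x, k (x - v) * g v =
      ∫⁻ v in Ioi (0:ℝ), (Ioi (0:ℝ)).indicator k (x - v) * g v := by
  rw [← lintegral_indicator measurableSet_Ioo, ← lintegral_indicator measurableSet_Ioi]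
  congr 1 with v
  by_cases h0 : 0 < v <;> by_cases hx : v < x <;> simp [indicator, h0, hx]

/-- Tonelli's theorem for a weighted causal convolution on `(0,∞)`. -/
lemma lintegral_mul_lintegral_Ioo_sub {w k g : ℝ → ENNReal} (hw : Measurable w)
    (hk : Measurable k) (hg : Measurable g) :
    ∫⁻ x in Ioi (0:ℝ), w x * ∫⁻ v in Ioo (0:ℝ) x, k (x - v) * g v =
      ∫⁻ v in Ioi (0:ℝ), g v * ∫⁻ y in Ioi (0:ℝ), w (y + v) * k y := by
  let k₀ : ℝ → ENNReal := (Ioi (0:ℝ)).indicator k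
  have hk₀ : Measurable k₀ := hk.indicator measurableSet_Ioi
  calc ∫⁻ x in Ioi (0:ℝ), w x * ∫⁻ v in Ioo (0:ℝ) x, k (x - v) * g v
      = ∫⁻ x in Ioi (0:ℝ), ∫⁻ v in Ioi (0:ℝ), w x * (k₀ (x - v) * g v) := by
        congr 1 with x
        rw [lintegral_Ioo_sub_eq_indicator, lintegral_const_mul _ (by fun_prop)]
    _ = ∫⁻ v in Ioi (0:ℝ), ∫⁻ x in Ioi (0:ℝ), w x * (k₀ (x - v) * g v) :=
        lintegral_lintegral_swap (by fun_prop)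
    _ = ∫⁻ v in Ioi (0:ℝ), g v * ∫⁻ y in Ioi (0:ℝ), w (y + v) * k y := by
        refine setLIntegral_congr_fun measurableSet_Ioi fun v hv => ?_
        have hv : 0 < v := hv
        have h1 : ∫⁻ x in Ioi (0:ℝ), w x * (k₀ (x - v) * g v) =
            ∫⁻ x, g v * (w ((x - v) + v) * k₀ (x - v)) := by
          rw [← lintegral_indicator measurableSet_Ioi]
          congr 1 with x
          by_cases hx : 0 < x
          · simp only [indicator, mem_Ioi, hx, if_true, sub_add_cancel]
            ring
          · have : ¬ v < x := by linarith
            simp [k₀, indicator, hx, this]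
        rw [h1, lintegral_sub_right_eq_self (fun y => g v * (w (y + v) * k₀ y)) v,
          lintegral_const_mul _ (by fun_prop), ← lintegral_indicator measurableSet_Ioi]
        congr 2 with y
        by_cases hy : 0 < y <;> simp [k₀, indicator, hy]

/-- The Beta integral on `(0,∞)`, in multiplicative form. -/
lemma lintegral_add_rpow_mul_rpow_mul_Gamma {α β v : ℝ} (hα : 0 < α) (hβ : 0 < β) (hv : 0 < v) :
    (∫⁻ y in Ioi (0:ℝ), ENNReal.ofReal ((y + v) ^ (-(α + β))) * ENNReal.ofReal (y ^ (α - 1))) *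
        ENNReal.ofReal (Real.Gamma (α + β)) =
      ENNReal.ofReal (v ^ (-β)) * ENNReal.ofReal (Real.Gamma α) *
        ENNReal.ofReal (Real.Gamma β) := by
  calc _ = ∫⁻ y in Ioi (0:ℝ), ∫⁻ t in Ioi (0:ℝ), ENNReal.ofReal (y ^ (α - 1)) *
          (ENNReal.ofReal (t ^ (α + β - 1)) * ENNReal.ofReal (Real.exp (-((y + v) * t)))) := by
        rw [← lintegral_mul_const _ (by fun_prop)]
        refine setLIntegral_congr_fun measurableSet_Ioi fun y hy => ?_
        rw [lintegral_const_mul _ (by fun_prop),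
          lintegral_rpow_mul_exp_neg_mul_Ioi (by positivity) (add_pos hy hv)]
        ring
    _ = ∫⁻ t in Ioi (0:ℝ), ∫⁻ y in Ioi (0:ℝ), ENNReal.ofReal (y ^ (α - 1)) *
          (ENNReal.ofReal (t ^ (α + β - 1)) * ENNReal.ofReal (Real.exp (-((y + v) * t)))) :=
        lintegral_lintegral_swap (by fun_prop)
    _ = ∫⁻ t in Ioi (0:ℝ), ENNReal.ofReal (Real.Gamma α) *
          (ENNReal.ofReal (t ^ (β - 1)) * ENNReal.ofReal (Real.exp (-(v * t)))) := by
        refine setLIntegral_congr_fun measurableSet_Ioi fun t ht => ?_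
        have ht : 0 < t := ht
        have h1 : ∀ y : ℝ, ENNReal.ofReal (y ^ (α - 1)) *
            (ENNReal.ofReal (t ^ (α + β - 1)) * ENNReal.ofReal (Real.exp (-((y + v) * t)))) =
            (ENNReal.ofReal (t ^ (α + β - 1)) * ENNReal.ofReal (Real.exp (-(v * t)))) *
            (ENNReal.ofReal (y ^ (α - 1)) * ENNReal.ofReal (Real.exp (-(t * y)))) := by
          intro y
          have : Real.exp (-((y + v) * t)) = Real.exp (-(v * t)) * Real.exp (-(t * y)) := by
            rw [← Real.exp_add]; ring_nf
          rw [this, ENNReal.ofReal_mul (Real.exp_pos _).le]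
          ring
        have h2 : t ^ (β - 1) = t ^ (α + β - 1) * t ^ (-α) := by
          rw [← Real.rpow_add ht]; ring_nf
        simp only [h1]
        rw [lintegral_const_mul _ (by fun_prop), lintegral_rpow_mul_exp_neg_mul_Ioi hα ht, h2,
          ENNReal.ofReal_mul (Real.rpow_nonneg ht.le _)]
        ring
    _ = _ := by
        rw [lintegral_const_mul _ (by fun_prop), lintegral_rpow_mul_exp_neg_mul_Ioi hβ hv]
        ring

/-- The fractional integral of an integrable density is finite almost everywhere. -/
lemma ae_lintegral_Ioo_sub_rpow_lt_top {α : ℝ} (hα : 0 < α) {g : ℝ → ENNReal}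
    (hg : Measurable g) (hfin : ∫⁻ v in Ioi (0:ℝ), g v ≠ ⊤) :
    ∀ᵐ x ∂(volume.restrict (Ioi (0:ℝ))),
      ∫⁻ v in Ioo (0:ℝ) x, ENNReal.ofReal ((x - v) ^ (α - 1)) * g v < ⊤ := by
  let w : ℝ → ENNReal := fun x => ENNReal.ofReal (Real.exp (-x))
  let k : ℝ → ENNReal := fun y => ENNReal.ofReal (y ^ (α - 1))
  have hw : Measurable w := by fun_prop
  have hk : Measurable k := by fun_prop
  have hmeas : Measurable fun x : ℝ => ∫⁻ v in Ioo (0:ℝ) x, k (x - v) * g v := by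
    simp only [lintegral_Ioo_sub_eq_indicator]
    have hk₀ : Measurable ((Ioi (0:ℝ)).indicator k) := hk.indicator measurableSet_Ioi
    exact Measurable.lintegral_prod_right' (f := fun p : ℝ × ℝ =>
      (Ioi (0:ℝ)).indicator k (p.1 - p.2) * g p.2) (by fun_prop)
  have hbound : ∫⁻ x in Ioi (0:ℝ), w x * ∫⁻ v in Ioo (0:ℝ) x, k (x - v) * g v ≠ ⊤ := by
    rw [lintegral_mul_lintegral_Ioo_sub hw hk hg]
    refine ne_top_of_le_ne_top (ENNReal.mul_ne_top hfin
      (ENNReal.ofReal_ne_top (r := Real.Gamma α))) ?_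
    rw [← lintegral_mul_const _ hg]
    refine setLIntegral_mono (by fun_prop) fun v hv => ?_
    have hv : 0 < v := hv
    gcongr
    have hG := lintegral_rpow_mul_exp_neg_mul_Ioi hα one_pos
    simp only [one_mul, Real.one_rpow, ENNReal.ofReal_one] at hG
    rw [← hG]
    refine setLIntegral_mono (by fun_prop) fun y _ => ?_
    rw [mul_comm]
    gcongr
    simp only [w]
    gcongr
    linarith
  filter_upwards [ae_lt_top (hw.mul hmeas) hbound] with x hx
  refine lt_top_iff_ne_top.2 fun h => hx.ne ?_
  change w x * ∫⁻ v in Ioo (0:ℝ) x, k (x - v) * g v = ⊤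
  have hwx : w x ≠ 0 := by simp [w, Real.exp_pos]
  rw [show ∫⁻ v in Ioo (0:ℝ) x, k (x - v) * g v = ⊤ from h, ENNReal.mul_top hwx]

/-- The equation satisfied by a density solution holds almost everywhere in `[0,∞]`. -/
lemma IsDensitySolution.ae_lintegral_eq {α m : ℝ} (hα : 0 < α) {f : ℝ → ℝ}
    (hf : IsDensitySolution α m f) :
    ∀ᵐ x ∂(volume.restrict (Ioi (0:ℝ))),
      ENNReal.ofReal (x ^ m * f x) * ENNReal.ofReal (Real.Gamma α) =
        ∫⁻ v in Ioo (0:ℝ) x, ENNReal.ofReal ((x - v) ^ (α - 1)) * ENNReal.ofReal (f v) := by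
  obtain ⟨hmeas, hnn, hone, heq⟩ := hf
  have hΓ : 0 < Real.Gamma α := Real.Gamma_pos_of_pos hα
  have hfin : ∫⁻ v in Ioi (0:ℝ), ENNReal.ofReal (f v) ≠ ⊤ := by
    have hI : Integrable f (volume.restrict (Ioi 0)) := by
      by_contra h
      rw [integral_undef h] at hone
      exact zero_ne_one hone
    exact hI.lintegral_lt_top.ne
  filter_upwards [ae_lintegral_Ioo_sub_rpow_lt_top hα (by fun_prop) hfin,
    ae_restrict_mem measurableSet_Ioi] with x hx hx0
  have hcongr : ∫⁻ v in Ioo (0:ℝ) x, ENNReal.ofReal ((x - v) ^ (α - 1)) * ENNReal.ofReal (f v) =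
      ∫⁻ v in Ioo (0:ℝ) x, ENNReal.ofReal ((x - v) ^ (α - 1) * f v) :=
    setLIntegral_congr_fun measurableSet_Ioo fun v hv =>
      (ENNReal.ofReal_mul (Real.rpow_nonneg (sub_nonneg.2 hv.2.le) _)).symm
  have hnn' : 0 ≤ᵐ[volume.restrict (Ioo (0:ℝ) x)] fun v => (x - v) ^ (α - 1) * f v := by
    filter_upwards [ae_restrict_mem measurableSet_Ioo] with v hv
    exact mul_nonneg (Real.rpow_nonneg (sub_nonneg.2 hv.2.le) _) (hnn v hv.1)
  rw [hcongr] at hx ⊢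
  have hI : Integrable (fun v => (x - v) ^ (α - 1) * f v) (volume.restrict (Ioo (0:ℝ) x)) :=
    (lintegral_ofReal_ne_top_iff_integrable
      (Measurable.aestronglyMeasurable (by fun_prop)) hnn').1 hx.ne
  rw [← ofReal_integral_eq_lintegral_ofReal hI hnn', ← ENNReal.ofReal_mul' hΓ.le, heq x hx0]
  congr 1
  field_simp

/-- The Mellin transform `M(s) = ∫_0^∞ x^{−s} f(x) dx ∈ [0,∞]` of a density
solution satisfies `M(s+a) Γ(a+s) = M(s) Γ(m+s)` for `s > −a`, `a = m − α`. -/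
theorem mellin_functional_equation (α m : ℝ) (hα : 0 < α) (hm : α < m)
    (f : ℝ → ℝ) (hf : IsDensitySolution α m f) :
    ∀ s : ℝ, -(m - α) < s →
      (∫⁻ x in Set.Ioi (0:ℝ), ENNReal.ofReal (x ^ (-(s + (m - α))) * f x)) *
          ENNReal.ofReal (Real.Gamma ((m - α) + s)) =
        (∫⁻ x in Set.Ioi (0:ℝ), ENNReal.ofReal (x ^ (-s) * f x)) *
          ENNReal.ofReal (Real.Gamma (m + s)) := by
  intro s hs
  have hβ : 0 < (m - α) + s := by linarith
  have hΓ : 0 < Real.Gamma α := Real.Gamma_pos_of_pos hα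
  have hmeas : Measurable f := hf.1
  have hconv : (∫⁻ x in Ioi (0:ℝ), ENNReal.ofReal (x ^ (-s) * f x)) *
      ENNReal.ofReal (Real.Gamma α) =
      ∫⁻ x in Ioi (0:ℝ), ENNReal.ofReal (x ^ (-(α + ((m - α) + s)))) *
        ∫⁻ v in Ioo (0:ℝ) x, ENNReal.ofReal ((x - v) ^ (α - 1)) * ENNReal.ofReal (f v) := by
    rw [← lintegral_mul_const _ (by fun_prop)]
    refine lintegral_congr_ae ?_
    filter_upwards [hf.ae_lintegral_eq hα, ae_restrict_mem measurableSet_Ioi] with x hx hx0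
    have hx0 : 0 < x := hx0
    rw [← hx, ← mul_assoc, ← ENNReal.ofReal_mul (Real.rpow_nonneg hx0.le _), ← mul_assoc,
      ← Real.rpow_add hx0]
    ring_nf
  have htonelli := lintegral_mul_lintegral_Ioo_sub
    (w := fun x => ENNReal.ofReal (x ^ (-(α + ((m - α) + s)))))
    (k := fun y => ENNReal.ofReal (y ^ (α - 1))) (g := fun v => ENNReal.ofReal (f v))
    (by fun_prop) (by fun_prop) (by fun_prop)
  have hbeta : (∫⁻ v in Ioi (0:ℝ), ENNReal.ofReal (f v) * ∫⁻ y in Ioi (0:ℝ),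
      ENNReal.ofReal ((y + v) ^ (-(α + ((m - α) + s)))) * ENNReal.ofReal (y ^ (α - 1))) *
        ENNReal.ofReal (Real.Gamma (m + s)) =
      (∫⁻ x in Ioi (0:ℝ), ENNReal.ofReal (x ^ (-(s + (m - α))) * f x)) *
        (ENNReal.ofReal (Real.Gamma α) * ENNReal.ofReal (Real.Gamma ((m - α) + s))) := by
    rw [← lintegral_mul_const' _ _ ENNReal.ofReal_ne_top, ← lintegral_mul_const _ (by fun_prop)]
    refine setLIntegral_congr_fun measurableSet_Ioi fun v hv => ?_
    have hv : 0 < v := hv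
    have key := lintegral_add_rpow_mul_rpow_mul_Gamma hα hβ hv
    rw [show m + s = α + ((m - α) + s) by ring, mul_assoc, key,
      ENNReal.ofReal_mul (Real.rpow_nonneg hv.le _), show -(s + (m - α)) = -(m - α + s) by ring]
    ring
  have hΓ0 : ENNReal.ofReal (Real.Gamma α) ≠ 0 := by simpa using hΓ
  rw [← ENNReal.mul_left_inj hΓ0 ENNReal.ofReal_ne_top]
  calc _ = _ := by rw [mul_assoc, mul_comm (ENNReal.ofReal (Real.Gamma (m - α + s))), ← hbeta]
    _ = _ := by rw [← htonelli, ← hconv]; ring
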